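/- Every finite CC-loop has the strong Lagrange property: if S and T are subloops of a finite CC-loop Q with S ⊆ T, then the cardinality of S divides the cardinality of T. -/

import Mathlib

/-- A loop: a type with multiplication, identity, and two-sided division. -/
class Loop (Q : Type*) extends Mul Q, One Q where
  ld : Q → Q → Q  -- left division: `ld x y = x \ y`
  rd : Q → Q → Q  -- right division: `rd x y = x / y`
  one_mul : ∀ x : Q, 1 * x = x
  mul_one : ∀ x : Q, x * 1 = x
  mul_ld : ∀ x y : Q, x * ld x y = y
  ld_mul : ∀ x y : Q, ld x (x * y) = y
  rd_mul : ∀ x y : Q, rd x y * y = x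
  mul_rd : ∀ x y : Q, rd (x * y) y = x

namespace Loop

variable {Q : Type*} [Loop Q]

/-- A conjugacy closed loop (CC-loop). -/
def IsCC (Q : Type*) [Loop Q] : Prop :=
  (∀ x y z : Q, x * (y * z) = rd (x * y) x * (x * z)) ∧
  (∀ x y z : Q, (z * y) * x = (z * x) * ld x (y * x))

/-- The nucleus `N(Q)`. -/
def nucleus (Q : Type*) [Loop Q] : Set Q :=
  {a | (∀ x y : Q, a * (x * y) = (a * x) * y) ∧
       (∀ x y : Q, x * (a * y) = (x * a) * y) ∧
       (∀ x y : Q, x * (y * a) = (x * y) * a)}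

/-- A subloop: contains 1 and is closed under `·`, `\`, `/`. -/
def IsSubloop (S : Set Q) : Prop :=
  (1 : Q) ∈ S ∧ (∀ a ∈ S, ∀ b ∈ S, a * b ∈ S) ∧
  (∀ a ∈ S, ∀ b ∈ S, ld a b ∈ S) ∧ (∀ a ∈ S, ∀ b ∈ S, rd a b ∈ S)

/-- The subloop generated by a set `S`. -/
def closure (S : Set Q) : Set Q := ⋂₀ {T : Set Q | IsSubloop T ∧ S ⊆ T}

/-- An element is power-associative if the subloop it generates is associative. -/
def IsPA (a : Q) : Prop :=
  ∀ x ∈ closure {a}, ∀ y ∈ closure {a}, ∀ z ∈ closure {a}, x * (y * z) = (x * y) * z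

/-- Powers: `pow a 0 = 1`, `pow a (n+1) = a * pow a n`. -/
def pow (a : Q) : ℕ → Q
  | 0 => 1
  | n + 1 => a * pow a n

/-- A WIP (weak inverse property) element. -/
def IsWIP (c : Q) : Prop := ∀ x : Q, c * ld (x * c) 1 = ld x 1

end Loop

open Loop

namespace Loop

section aux
variable {Q : Type*} [Loop Q]

theorem lcancel {a x y : Q} (h : a * x = a * y) : x = y := by
  rw [← ld_mul a x, h, ld_mul]

theorem rcancel {a x y : Q} (h : x * a = y * a) : x = y := by
  rw [← mul_rd x a, h, mul_rd]

def LT (a : Q) : Equiv.Perm Q where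
  toFun x := a * x
  invFun x := ld a x
  left_inv x := ld_mul a x
  right_inv x := mul_ld a x

def RT (a : Q) : Equiv.Perm Q where
  toFun x := x * a
  invFun x := rd x a
  left_inv x := mul_rd x a
  right_inv x := rd_mul x a

@[simp] theorem LT_apply (a x : Q) : LT a x = a * x := rfl
@[simp] theorem RT_apply (a x : Q) : RT a x = x * a := rfl
@[simp] theorem LT_inv_apply (a x : Q) : (LT a)⁻¹ x = ld a x := rfl
@[simp] theorem RT_inv_apply (a x : Q) : (RT a)⁻¹ x = rd x a := rfl

def Atp (α β γ : Equiv.Perm Q) : Prop := ∀ x y : Q, α x * β y = γ (x * y)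

theorem Atp.mul {α β γ α' β' γ' : Equiv.Perm Q} (h : Atp α β γ) (h' : Atp α' β' γ') :
    Atp (α * α') (β * β') (γ * γ') := by
  intro x y
  simp only [Equiv.Perm.mul_apply]
  rw [h, h']

theorem Atp.inv {α β γ : Equiv.Perm Q} (h : Atp α β γ) : Atp α⁻¹ β⁻¹ γ⁻¹ := by
  intro x y
  apply γ.injective
  rw [← h]
  simp

def LN (Q : Type*) [Loop Q] : Set Q := {n | ∀ x y : Q, n * (x * y) = (n * x) * y}

theorem Atp.nuc {α γ : Equiv.Perm Q} (h : Atp α 1 γ) :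
    ∃ n ∈ LN Q, ∀ x, γ x = n * x := by
  have h1 : ∀ x, α x = γ x := fun x => by
    have := h x 1
    simpa [Loop.mul_one] using this
  have h2 : ∀ x, γ x = γ 1 * x := fun x => by
    have := h 1 x
    simpa [Loop.one_mul, h1] using this.symm
  refine ⟨γ 1, fun x y => ?_, h2⟩
  rw [← h2, ← h2, ← h1 x]
  exact (h x y).symm

theorem Atp_E (hcc : IsCC Q) (x : Q) : Atp ((RT x)⁻¹ * LT x) (LT x) (LT x) := by
  intro y z
  exact (hcc.1 x y z).symm

theorem Atp_F (hcc : IsCC Q) (x : Q) : Atp (RT x) ((LT x)⁻¹ * RT x) (RT x) := by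
  intro z y
  exact (hcc.2 x y z).symm

theorem conjR (hcc : IsCC Q) (x z : Q) : RT x * LT z * (RT x)⁻¹ = LT (z * x) * (LT x)⁻¹ := by
  rw [mul_inv_eq_iff_eq_mul]
  ext y
  have := hcc.2 x y z
  simp only [Equiv.Perm.mul_apply, RT_apply, LT_apply, LT_inv_apply]
  exact this

theorem key (hcc : IsCC Q) (a z : Q) : ∃ n ∈ LN Q, ∀ w, a * w = n * ld z (a * (z * w)) := by
  obtain ⟨x, rfl⟩ : ∃ x, a = x * z := ⟨rd a z, (rd_mul a z).symm⟩
  have h := ((((Atp_F hcc z).mul (Atp_E hcc x)).mul (Atp_F hcc z).inv).mul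
    (Atp_E hcc (x * z)).inv).mul (Atp_E hcc z)
  have hc := conjR hcc z x
  have h2 : (LT z)⁻¹ * RT z * LT x * ((LT z)⁻¹ * RT z)⁻¹ * (LT (x * z))⁻¹ * LT z = 1 := by
    have : (LT z)⁻¹ * RT z * LT x * ((LT z)⁻¹ * RT z)⁻¹ * (LT (x * z))⁻¹ * LT z
      = (LT z)⁻¹ * (RT z * LT x * (RT z)⁻¹) * LT z * (LT (x * z))⁻¹ * LT z := by group
    rw [this, hc]; group
  rw [h2] at h
  obtain ⟨n, hn, hx⟩ := h.nuc
  refine ⟨n, hn, fun w => ?_⟩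
  rw [hc] at hx
  rw [← hx]
  simp only [Equiv.Perm.mul_apply, LT_apply, LT_inv_apply, mul_ld, ld_mul]

theorem LN_one : (1 : Q) ∈ LN Q := fun x y => by simp only [Loop.one_mul]

theorem LN_mul {a b : Q} (ha : a ∈ LN Q) (hb : b ∈ LN Q) : a * b ∈ LN Q := fun x y => by
  rw [← ha, hb, ha, ha]

theorem LN_ld {a : Q} (ha : a ∈ LN Q) : ld a 1 ∈ LN Q := fun x y => by
  apply lcancel (a := a)
  rw [ha, ha, ha, mul_ld, Loop.one_mul, Loop.one_mul]

theorem LN_ld_mul {a : Q} (ha : a ∈ LN Q) : ld a 1 * a = 1 := by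
  apply lcancel (a := a)
  rw [ha, mul_ld, Loop.one_mul, Loop.mul_one]

def lnGroup (Q : Type*) [Loop Q] : Group (LN Q) where
  mul a b := ⟨a.1 * b.1, LN_mul a.2 b.2⟩
  one := ⟨1, LN_one⟩
  inv a := ⟨ld a.1 1, LN_ld a.2⟩
  mul_assoc a b c := Subtype.ext (a.2 b.1 c.1).symm
  one_mul a := Subtype.ext (Loop.one_mul a.1)
  mul_one a := Subtype.ext (Loop.mul_one a.1)
  inv_mul_cancel a := Subtype.ext (LN_ld_mul a.2)

theorem card_inter_dvd [Finite Q] {S : Set Q} (hS : IsSubloop S) :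
    Nat.card (LN Q ∩ S : Set Q) ∣ Nat.card (LN Q) := by
  letI := lnGroup Q
  let H : Subgroup (LN Q) :=
    { carrier := {n | n.1 ∈ S}
      mul_mem' := fun {a b} ha hb => hS.2.1 a.1 ha b.1 hb
      one_mem' := hS.1
      inv_mem' := fun {a} ha => hS.2.2.1 a.1 ha 1 hS.1 }
  have h := H.card_subgroup_dvd_card
  have e : Nat.card H = Nat.card (LN Q ∩ S : Set Q) :=
    Nat.card_congr
      { toFun := fun n => ⟨n.1.1, n.1.2, n.2⟩
        invFun := fun n => ⟨⟨n.1, n.2.1⟩, n.2.2⟩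
        left_inv := fun _ => rfl
        right_inv := fun _ => rfl }
  rwa [e] at h

def rel (Q : Type*) [Loop Q] : Setoid Q where
  r x y := ∃ n ∈ LN Q, y = n * x
  iseqv :=
    { refl := fun x => ⟨1, LN_one, (Loop.one_mul x).symm⟩
      symm := by
        rintro x y ⟨n, hn, rfl⟩
        exact ⟨ld n 1, LN_ld hn, by rw [LN_ld hn, LN_ld_mul hn, Loop.one_mul]⟩
      trans := by
        rintro x y z ⟨n, hn, rfl⟩ ⟨m, hm, rfl⟩
        exact ⟨m * n, LN_mul hm hn, by rw [hm]⟩ }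

theorem LN_conj (hcc : IsCC Q) (x : Q) {n : Q} (hn : n ∈ LN Q) : rd (x * n) x ∈ LN Q := by
  have h0 : Atp (LT n) 1 (LT n) := fun a b => (hn a b).symm
  have h := ((Atp_E hcc x).mul h0).mul (Atp_E hcc x).inv
  rw [_root_.mul_one, mul_inv_cancel] at h
  obtain ⟨m, hm, hx⟩ := h.nuc
  have : rd (x * n) x = m := by
    have := hx x
    simp only [Equiv.Perm.mul_apply, LT_apply, LT_inv_apply] at this
    have e : ld x x = 1 := lcancel (a := x) (by rw [mul_ld, Loop.mul_one])
    rw [e, Loop.mul_one] at this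
    rw [this, mul_rd]
  rwa [this]

theorem rel_mul (hcc : IsCC Q) {a b c d : Q} (h : rel Q a b) (h' : rel Q c d) :
    rel Q (a * c) (b * d) := by
  obtain ⟨n, hn, rfl⟩ := h
  obtain ⟨m, hm, rfl⟩ := h'
  refine ⟨n * rd (a * m) a, LN_mul hn (LN_conj hcc a hm), ?_⟩
  rw [← hn, ← hn, hcc.1 a m c]

theorem rel_lcomm (hcc : IsCC Q) (z a w : Q) : rel Q (a * (z * w)) (z * (a * w)) := by
  obtain ⟨n, hn, h⟩ := key hcc a z
  have : rel Q (ld z (a * (z * w))) (a * w) := ⟨n, hn, h w⟩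
  have := rel_mul hcc ((rel Q).refl z) this
  rwa [mul_ld] at this

theorem rel_comm (hcc : IsCC Q) (z a : Q) : rel Q (a * z) (z * a) := by
  have := rel_lcomm hcc z a 1
  rwa [Loop.mul_one, Loop.mul_one] at this

theorem rel_assoc (hcc : IsCC Q) (x y z : Q) : rel Q (x * y * z) (x * (y * z)) := by
  have h1 := rel_comm hcc z (x * y)
  have h2 := rel_lcomm hcc x z y
  have h3 := rel_mul hcc ((rel Q).refl x) (rel_comm hcc y z)
  exact (rel Q).trans h1 ((rel Q).trans h2 h3)

noncomputable def quotGroup (hcc : IsCC Q) : Group (Quotient (rel Q)) where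
  mul := Quotient.map₂ (· * ·) (fun _ _ h _ _ h' => rel_mul hcc h h')
  one := Quotient.mk _ 1
  inv x := Quotient.mk _ (ld x.out 1)
  mul_assoc := by
    rintro ⟨x⟩ ⟨y⟩ ⟨z⟩
    exact Quotient.sound (rel_assoc hcc x y z)
  one_mul := by
    rintro ⟨x⟩
    exact congrArg (Quotient.mk (rel Q)) (Loop.one_mul x)
  mul_one := by
    rintro ⟨x⟩
    exact congrArg (Quotient.mk (rel Q)) (Loop.mul_one x)
  inv_mul_cancel := by
    intro x
    conv_lhs => arg 2; rw [← x.out_eq]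
    have h := rel_comm hcc x.out (ld x.out 1)
    rw [mul_ld] at h
    exact Quotient.sound h

theorem card_image_dvd [Finite Q] (hcc : IsCC Q) {S : Set Q} (hS : IsSubloop S) :
    Nat.card (Quotient.mk (rel Q) '' S : Set _) ∣ Nat.card (Quotient (rel Q)) := by
  letI := quotGroup hcc
  let M : Submonoid (Quotient (rel Q)) :=
    { carrier := Quotient.mk (rel Q) '' S
      mul_mem' := by
        rintro _ _ ⟨a, ha, rfl⟩ ⟨b, hb, rfl⟩
        exact ⟨a * b, hS.2.1 a ha b hb, rfl⟩
      one_mem' := ⟨1, hS.1, rfl⟩ }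
  let H : Subgroup (Quotient (rel Q)) :=
    { M with
      inv_mem' := by
        rintro _ ⟨a, ha, rfl⟩
        refine ⟨ld a 1, hS.2.2.1 a ha 1 hS.1, ?_⟩
        apply eq_inv_of_mul_eq_one_right
        exact congrArg (Quotient.mk (rel Q)) (mul_ld a 1) }
  exact H.card_subgroup_dvd_card

theorem card_eq {S : Set Q} (hS : IsSubloop S) :
    Nat.card S = Nat.card (LN Q ∩ S : Set Q) * Nat.card (Quotient.mk (rel Q) '' S : Set _) := by
  rw [← Nat.card_prod]
  symm
  choose f hf hf' using fun c : (Quotient.mk (rel Q) '' S : Set _) => c.2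
  let g : (LN Q ∩ S : Set Q) × (Quotient.mk (rel Q) '' S : Set _) → S :=
    fun p => ⟨p.1.1 * f p.2, hS.2.1 _ p.1.2.2 _ (hf p.2)⟩
  apply Nat.card_congr
  apply Equiv.ofBijective g
  constructor
  · rintro ⟨n, c⟩ ⟨m, d⟩ h
    have h : n.1 * f c = m.1 * f d := congrArg Subtype.val h
    have hcd : c = d := by
      apply Subtype.ext
      rw [← hf' c, ← hf' d]
      have e1 : Quotient.mk (rel Q) (f c) = Quotient.mk (rel Q) (n.1 * f c) :=
        Quotient.sound ⟨n.1, n.2.1, rfl⟩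
      have e2 : Quotient.mk (rel Q) (f d) = Quotient.mk (rel Q) (m.1 * f d) :=
        Quotient.sound ⟨m.1, m.2.1, rfl⟩
      rw [e1, e2, h]
    subst hcd
    have : n = m := Subtype.ext (rcancel h)
    rw [this]
  · rintro ⟨s, hs⟩
    let c : (Quotient.mk (rel Q) '' S : Set _) := ⟨Quotient.mk _ s, s, hs, rfl⟩
    obtain ⟨n, hn, e⟩ := Quotient.exact (hf' c)
    have hnS : n ∈ S := by
      have := hS.2.2.2 s hs (f c) (hf c)
      rwa [e, mul_rd] at this
    exact ⟨(⟨n, hn, hnS⟩, c), Subtype.ext e.symm⟩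

theorem lagrange [Finite Q] (hcc : IsCC Q) {S : Set Q} (hS : IsSubloop S) :
    Nat.card S ∣ Nat.card Q := by
  have hU : IsSubloop (Set.univ : Set Q) := by simp [IsSubloop]
  have h2 := card_eq hU
  rw [Nat.card_univ, Set.inter_univ, Set.image_univ,
    Set.range_eq_univ.mpr Quotient.mk_surjective, Nat.card_univ] at h2
  rw [h2, card_eq hS]
  exact mul_dvd_mul (card_inter_dvd hS) (card_image_dvd hcc hS)

@[reducible] def subLoop {T : Set Q} (hT : IsSubloop T) : Loop T where
  mul a b := ⟨a.1 * b.1, hT.2.1 _ a.2 _ b.2⟩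
  one := ⟨1, hT.1⟩
  ld a b := ⟨ld a.1 b.1, hT.2.2.1 _ a.2 _ b.2⟩
  rd a b := ⟨rd a.1 b.1, hT.2.2.2 _ a.2 _ b.2⟩
  one_mul x := Subtype.ext (Loop.one_mul x.1)
  mul_one x := Subtype.ext (Loop.mul_one x.1)
  mul_ld x y := Subtype.ext (mul_ld x.1 y.1)
  ld_mul x y := Subtype.ext (ld_mul x.1 y.1)
  rd_mul x y := Subtype.ext (rd_mul x.1 y.1)
  mul_rd x y := Subtype.ext (mul_rd x.1 y.1)

end aux

end Loop


/-- Every finite CC-loop has the strong Lagrange property. -/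
theorem stmt_1 {Q : Type*} [Loop Q] [Finite Q] (hcc : IsCC Q)
    (S T : Set Q) (hS : IsSubloop S) (hT : IsSubloop T) (hST : S ⊆ T) :
    Nat.card S ∣ Nat.card T := by
  letI := subLoop hT
  have hc : IsCC T := ⟨fun x y z => Subtype.ext (hcc.1 x.1 y.1 z.1),
    fun x y z => Subtype.ext (hcc.2 x.1 y.1 z.1)⟩
  have hS' : IsSubloop (Subtype.val ⁻¹' S : Set T) :=
    ⟨hS.1, fun a ha b hb => hS.2.1 a.1 ha b.1 hb, fun a ha b hb => hS.2.2.1 a.1 ha b.1 hb,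
      fun a ha b hb => hS.2.2.2 a.1 ha b.1 hb⟩
  have h := lagrange hc hS'
  have e : Nat.card (Subtype.val ⁻¹' S : Set T) = Nat.card S :=
    Nat.card_congr
      { toFun := fun n => ⟨n.1.1, n.2⟩
        invFun := fun n => ⟨⟨n.1, hST n.2⟩, n.2⟩
        left_inv := fun _ => rfl
        right_inv := fun _ => rfl }
  rwa [e] at h
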